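/- The group algebras ℤ_{(7)}C_3 (localization of ℤ at 7) and ℤC_3 of the cyclic group of order 3 do not admit a split quasi-hereditary cover: there is no split quasi-hereditary algebra A over ℤ_{(7)} (resp. ℤ) together with a finitely generated projective A-module P such that End_A(P)^op ≅ ℤ_{(7)}C_3 (resp. ℤC_3) and Hom_A(P, −) is fully faithful on A-proj. -/

import Mathlib

open Function


section SchurFramework

variable {A : Type} [Ring A] {P : Type} [AddCommGroup P] [Module A P]

/-- `B = End_A(P)ᵒᵖ`. -/
abbrev Bop (A : Type) [Ring A] (P : Type) [AddCommGroup P] [Module A P] : Type :=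
  (Module.End A P)ᵐᵒᵖ

/-- `F M = Hom_A(P, M)` is a left `B`-module via precomposition. -/
instance instSMulBop (M : Type) [AddCommGroup M] [Module A M] :
    SMul (Bop A P) (P →ₗ[A] M) :=
  ⟨fun b φ => φ.comp b.unop⟩

@[simp] lemma smulBop_apply {M : Type} [AddCommGroup M] [Module A M]
    (b : Bop A P) (φ : P →ₗ[A] M) (p : P) : (b • φ) p = φ (b.unop p) := rfl

instance instModuleBop (M : Type) [AddCommGroup M] [Module A M] :
    Module (Bop A P) (P →ₗ[A] M) where
  one_smul φ := LinearMap.ext fun p => rfl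
  mul_smul b c φ := LinearMap.ext fun p => rfl
  smul_zero b := rfl
  smul_add b φ ψ := rfl
  add_smul b c φ := LinearMap.ext fun p => by
    simp only [smulBop_apply, MulOpposite.unop_add, LinearMap.add_apply, map_add]
  zero_smul φ := LinearMap.ext fun p => by
    simp only [smulBop_apply, MulOpposite.unop_zero, LinearMap.zero_apply, map_zero,
      LinearMap.zero_apply]

/-- Right multiplication by `a` on `F A = Hom_A(P, A)`, as a `B`-linear endomorphism.
This gives `F A` its right `A`-module structure. -/
def rmulA (a : A) : (P →ₗ[A] A) →ₗ[Bop A P] (P →ₗ[A] A) where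
  toFun f :=
    { toFun := fun p => f p * a
      map_add' := fun p q => by simp [add_mul]
      map_smul' := fun c p => by simp [smul_eq_mul, mul_assoc] }
  map_add' f g := LinearMap.ext fun p => by simp [add_mul]
  map_smul' b f := LinearMap.ext fun p => rfl

@[simp] lemma rmulA_apply (a : A) (f : P →ₗ[A] A) (p : P) : rmulA a f p = f p * a := rfl

lemma rmulA_one : (rmulA (A := A) (P := P) 1) = LinearMap.id :=
  LinearMap.ext fun f => LinearMap.ext fun p => by simp

lemma rmulA_mul (a b : A) :
    (rmulA (A := A) (P := P) (a * b)) = (rmulA b).comp (rmulA a) :=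
  LinearMap.ext fun f => LinearMap.ext fun p => by simp [mul_assoc]

lemma rmulA_add (a b : A) :
    (rmulA (A := A) (P := P) (a + b)) = rmulA a + rmulA b :=
  LinearMap.ext fun f => LinearMap.ext fun p => by simp [mul_add]

lemma rmulA_zero : (rmulA (A := A) (P := P) 0) = 0 :=
  LinearMap.ext fun f => LinearMap.ext fun p => by simp

/-- `G N = Hom_B(FA, N)` is a left `A`-module, via the right `A`-module structure of `FA`. -/
instance instSMulGA (N : Type) [AddCommGroup N] [Module (Bop A P) N] :
    SMul A ((P →ₗ[A] A) →ₗ[Bop A P] N) :=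
  ⟨fun a g => g.comp (rmulA a)⟩

@[simp] lemma smulGA_apply {N : Type} [AddCommGroup N] [Module (Bop A P) N]
    (a : A) (g : (P →ₗ[A] A) →ₗ[Bop A P] N) (f : P →ₗ[A] A) :
    (a • g) f = g (rmulA a f) := rfl

instance instModuleGA (N : Type) [AddCommGroup N] [Module (Bop A P) N] :
    Module A ((P →ₗ[A] A) →ₗ[Bop A P] N) where
  one_smul g := show g.comp (rmulA 1) = g by rw [rmulA_one, LinearMap.comp_id]
  mul_smul a b g := show g.comp (rmulA (a * b)) = (g.comp (rmulA b)).comp (rmulA a) by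
    rw [rmulA_mul, LinearMap.comp_assoc]
  smul_zero a := LinearMap.zero_comp _
  smul_add a g h := LinearMap.add_comp _ _ _
  add_smul a b g := show g.comp (rmulA (a + b)) = g.comp (rmulA a) + g.comp (rmulA b) by
    rw [rmulA_add, LinearMap.comp_add]
  zero_smul g := show g.comp (rmulA 0) = 0 by rw [rmulA_zero, LinearMap.comp_zero]

/-- For `f ∈ Hom_A(P, A)` and `x ∈ X`, the map `p ↦ f p • x`, an element of `F X`. -/
def starMap {X : Type} [AddCommGroup X] [Module A X] (f : P →ₗ[A] A) (x : X) :
    P →ₗ[A] X where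
  toFun p := f p • x
  map_add' p q := by simp [add_smul]
  map_smul' a p := by simp [smul_eq_mul, mul_smul]

@[simp] lemma starMap_apply {X : Type} [AddCommGroup X] [Module A X]
    (f : P →ₗ[A] A) (x : X) (p : P) : starMap f x p = f p • x := rfl

lemma starMap_addl {X : Type} [AddCommGroup X] [Module A X] (f g : P →ₗ[A] A) (x : X) :
    starMap (f + g) x = starMap f x + starMap g x :=
  LinearMap.ext fun p => by simp [add_smul]

lemma starMap_smulB {X : Type} [AddCommGroup X] [Module A X] (b : Bop A P)
    (f : P →ₗ[A] A) (x : X) : starMap (b • f) x = b • starMap f x :=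
  LinearMap.ext fun p => rfl

lemma starMap_smulA {X : Type} [AddCommGroup X] [Module A X] (a : A)
    (f : P →ₗ[A] A) (x : X) : starMap f (a • x) = starMap (rmulA a f) x :=
  LinearMap.ext fun p => by simp [mul_smul]

/-- The adjunction bijection `Φ : Hom_B(F X, M) → Hom_A(X, G M)` of `F ⊣ G`. -/
def PhiAdj {X : Type} [AddCommGroup X] [Module A X]
    {M : Type} [AddCommGroup M] [Module (Bop A P) M]
    (k : (P →ₗ[A] X) →ₗ[Bop A P] M) :
    X →ₗ[A] ((P →ₗ[A] A) →ₗ[Bop A P] M) where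
  toFun x :=
    { toFun := fun f => k (starMap f x)
      map_add' := fun f g => by
        show k (starMap (f + g) x) = k (starMap f x) + k (starMap g x)
        rw [starMap_addl, map_add]
      map_smul' := fun b f => by
        show k (starMap (b • f) x) = b • k (starMap f x)
        rw [starMap_smulB, map_smul] }
  map_add' x y := LinearMap.ext fun f => by
    have : starMap f (x + y) = starMap f x + starMap f y :=
      LinearMap.ext fun p => by simp [smul_add]
    simp [this]
  map_smul' a x := LinearMap.ext fun f => by
    simp [starMap_smulA]

/-- `G` on morphisms: post-composition. -/
def Gmap {M N : Type} [AddCommGroup M] [Module (Bop A P) M]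
    [AddCommGroup N] [Module (Bop A P) N] (g : M →ₗ[Bop A P] N) :
    ((P →ₗ[A] A) →ₗ[Bop A P] M) →ₗ[A] ((P →ₗ[A] A) →ₗ[Bop A P] N) where
  toFun φ := g.comp φ
  map_add' φ ψ := LinearMap.ext fun f => by simp
  map_smul' a φ := LinearMap.ext fun f => rfl


/-- `F` on morphisms: post-composition with `h`. -/
def Fmap {M N : Type} [AddCommGroup M] [Module A M] [AddCommGroup N] [Module A N]
    (h : M →ₗ[A] N) : (P →ₗ[A] M) →ₗ[Bop A P] (P →ₗ[A] N) where
  toFun φ := h.comp φ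
  map_add' φ ψ := LinearMap.ext fun p => by simp
  map_smul' b φ := LinearMap.ext fun p => rfl

/-- The unit `η_X : X → G F X` of the adjunction `F ⊣ G`;
explicitly `η x f p = f p • x`. -/
def etaL (X : Type) [AddCommGroup X] [Module A X] :
    X →ₗ[A] ((P →ₗ[A] A) →ₗ[Bop A P] (P →ₗ[A] X)) :=
  PhiAdj (LinearMap.id : (P →ₗ[A] X) →ₗ[Bop A P] (P →ₗ[A] X))

end SchurFramework

section Basics

/-- A predicate on left `A`-modules. -/
def ModPred (A : Type) [Ring A] : Type 1 :=
  (M : Type) → [AddCommGroup M] → [Module A M] → Prop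

/-- `T` is a direct summand of `W` (as `A`-modules). -/
def IsSummandOf (A : Type) [Ring A] (T W : Type) [AddCommGroup T] [Module A T]
    [AddCommGroup W] [Module A W] : Prop :=
  ∃ (i : T →ₗ[A] W) (r : W →ₗ[A] T), r.comp i = LinearMap.id

/-- `M` has a finite filtration whose subquotients lie in `Θ`. -/
inductive HasFilt (A : Type) [Ring A] (Θ : ModPred A) :
    (M : Type) → [AddCommGroup M] → [Module A M] → Prop
  | of_subsingleton (M : Type) [AddCommGroup M] [Module A M] :
      Subsingleton M → HasFilt A Θ M
  | step (K M Q : Type) [AddCommGroup K] [Module A K] [AddCommGroup M] [Module A M]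
      [AddCommGroup Q] [Module A Q] (i : K →ₗ[A] M) (p : M →ₗ[A] Q)
      (hi : Function.Injective i) (hp : Function.Surjective p)
      (hex : Function.Exact i p) (hQ : Θ Q) (hK : HasFilt A Θ K) : HasFilt A Θ M

end Basics

section QuasiHereditary

/-- A split quasi-hereditary structure on the `R`-algebra `A` (weight poset `Λ`, standard
modules `Δ λ`):
(i) each `Δ(λ)` is finitely generated projective over `R`;
(ii) `Hom_A(Δ(λ), Δ(μ)) ≠ 0` implies `λ ≤ μ`;
(iii) `End_A(Δ(λ)) ≅ R`;
(iv) each `Δ(λ)` is covered by a finitely generated projective `P(λ)` whose kernel is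
filtered by modules `Δ(μ) ⊗ U` (`U ∈ R`-proj, `μ > λ`), realised as direct summands of
finite direct sums of copies of `Δ(μ)`, `μ > λ`;
(v) `⨁ P(λ)` is a progenerator. -/
structure SplitQH (R : Type) [CommRing R] (A : Type) [Ring A] [Algebra R A] : Type 1 where
  Λ : Type
  [po : PartialOrder Λ]
  [fintypeΛ : Fintype Λ]
  Δ : Λ → Type
  [grp : ∀ l, AddCommGroup (Δ l)]
  [mod : ∀ l, Module A (Δ l)]
  [modR : ∀ l, Module R (Δ l)]
  [tower : ∀ l, IsScalarTower R A (Δ l)]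
  [scc : ∀ l, SMulCommClass A R (Δ l)]
  fin : ∀ l, Module.Finite A (Δ l)
  rproj : ∀ l, Module.Finite R (Δ l) ∧ Module.Projective R (Δ l)
  hom_le : ∀ l m, (∃ φ : Δ l →ₗ[A] Δ m, φ ≠ 0) → l ≤ m
  endo : ∀ (l : Λ) (φ : Δ l →ₗ[A] Δ l), ∃ c : R, φ = c • (LinearMap.id : Δ l →ₗ[A] Δ l)
  Pr : Λ → Type
  [pgrp : ∀ l, AddCommGroup (Pr l)]
  [pmod : ∀ l, Module A (Pr l)]
  pfin : ∀ l, Module.Finite A (Pr l)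
  pproj : ∀ l, Module.Projective A (Pr l)
  π : ∀ l, Pr l →ₗ[A] Δ l
  hπ : ∀ l, Function.Surjective (π l)
  kernel_filtered : ∀ l, ∃ (C : ModuleCat A) (ι : C →ₗ[A] Pr l),
    Function.Injective ι ∧ Function.Exact ι (π l) ∧
      HasFilt A (fun T [AddCommGroup T] [Module A T] =>
        ∃ m, l < m ∧ ∃ n : ℕ, IsSummandOf A T (Fin n → Δ m)) C
  progen : ∃ n : ℕ, IsSummandOf A A (Fin n → ∀ l, Pr l)

end QuasiHereditary

/-- A split quasi-hereditary cover of the ring `C` over `R`: a split quasi-hereditary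
projective Noetherian `R`-algebra `A` together with a finitely generated projective
`A`-module `P` such that `End_A(P)ᵒᵖ ≅ C` and the Schur functor `Hom_A(P, −)` is fully
faithful on finitely generated projective `A`-modules. -/
structure SplitQHCover (R : Type) [CommRing R] (C : Type) [Ring C] : Type 1 where
  A : Type
  [ringA : Ring A]
  [algA : Algebra R A]
  finA : Module.Finite R A
  projA : Module.Projective R A
  qh : SplitQH R A
  Pm : Type
  [grpP : AddCommGroup Pm]
  [modP : Module A Pm]
  finP : Module.Finite A Pm
  projP : Module.Projective A Pm
  iso : (Module.End A Pm)ᵐᵒᵖ ≃+* C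
  cover : ∀ (M N : Type) [AddCommGroup M] [Module A M] [AddCommGroup N] [Module A N],
    Module.Finite A M → Module.Projective A M → Module.Finite A N → Module.Projective A N →
    Function.Bijective (fun h : M →ₗ[A] N => Fmap (A := A) (P := Pm) h)

instance : (Ideal.span {(7 : ℤ)}).IsPrime := by
  rw [Ideal.span_singleton_prime (by norm_num : (7 : ℤ) ≠ 0)]
  norm_num


attribute [instance] SplitQH.po SplitQH.fintypeΛ SplitQH.grp SplitQH.mod SplitQH.modR
  SplitQH.tower SplitQH.scc SplitQH.pgrp SplitQH.pmod
  SplitQHCover.ringA SplitQHCover.algA SplitQHCover.grpP SplitQHCover.modP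

section Domination

variable {A : Type} [Ring A] {P : Type} [AddCommGroup P] [Module A P]

/-- Some endomorphism of `P` factoring through `X` is not annihilated by `e`. -/
def Dominates (e : Module.End A P) (X : Type) [AddCommGroup X] [Module A X] : Prop :=
  ∃ (f : X →ₗ[A] P) (s : P →ₗ[A] X), e ∘ₗ f ∘ₗ s ≠ 0

lemma Dominates.of_summand {e : Module.End A P} {T W : Type} [AddCommGroup T] [Module A T]
    [AddCommGroup W] [Module A W] (h : Dominates e T) (hTW : IsSummandOf A T W) :
    Dominates e W := by
  obtain ⟨f, s, hfs⟩ := h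
  obtain ⟨i, r, hri⟩ := hTW
  refine ⟨f ∘ₗ r, i ∘ₗ s, ?_⟩
  rwa [LinearMap.comp_assoc, ← LinearMap.comp_assoc s i r, hri, LinearMap.id_comp]

lemma Dominates.exists_of_pi {e : Module.End A P} {ι : Type} [Fintype ι] {X : ι → Type}
    [∀ i, AddCommGroup (X i)] [∀ i, Module A (X i)] (h : Dominates e (∀ i, X i)) :
    ∃ i, Dominates e (X i) := by
  classical
  obtain ⟨f, s, hfs⟩ := h
  by_contra! hX
  refine hfs (LinearMap.ext fun p => ?_)
  have key : ∀ i, e (f (Pi.single i (s p i))) = 0 := fun i => by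
    have := hX i
    simp only [Dominates, not_exists, not_not] at this
    exact LinearMap.congr_fun (this (f ∘ₗ LinearMap.single A X i) (LinearMap.proj i ∘ₗ s)) p
  have hs : s p = ∑ i, Pi.single i (s p i) := (Finset.univ_sum_single (s p)).symm
  simp only [LinearMap.comp_apply, LinearMap.zero_apply]
  rw [hs, map_sum, map_sum]
  exact Finset.sum_eq_zero fun i _ => key i

lemma Dominates.of_extension [Module.Projective A P] {e : Module.End A P}
    {K M T F : Type} [AddCommGroup K] [Module A K] [AddCommGroup M] [Module A M]
    [AddCommGroup T] [Module A T] [AddCommGroup F] [Module A F] [Module.Projective A F]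
    {i : K →ₗ[A] M} {p : M →ₗ[A] T} (hi : Injective i) (hp : Surjective p) (hex : Exact i p)
    {t : F →ₗ[A] T} (ht : Surjective t) (h : Dominates e M) :
    Dominates e K ∨ Dominates e F := by
  obtain ⟨f, s, hfs⟩ := h
  obtain ⟨j, hj⟩ := Module.projective_lifting_property p t hp
  obtain ⟨s', hs'⟩ := Module.projective_lifting_property t (p ∘ₗ s) ht
  have hker : ∀ x, (s - j ∘ₗ s') x ∈ LinearMap.range i := fun x => by
    have h1 := LinearMap.congr_fun hj (s' x)
    have h2 := LinearMap.congr_fun hs' x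
    simp only [LinearMap.comp_apply] at h1 h2
    exact (hex _).1 (by simp [h1, h2])
  let s'' : P →ₗ[A] K := (LinearEquiv.ofInjective i hi).symm.toLinearMap ∘ₗ
    (s - j ∘ₗ s').codRestrict _ hker
  have hs'' : ∀ x, i (s'' x) = s x - j (s' x) := fun x =>
    congrArg Subtype.val ((LinearEquiv.ofInjective i hi).apply_symm_apply ⟨_, hker x⟩)
  by_contra! hcon
  obtain ⟨hK, hF⟩ := hcon
  simp only [Dominates, not_exists, not_not] at hK hF
  refine hfs (LinearMap.ext fun x => ?_)
  have h1 := LinearMap.congr_fun (hK (f ∘ₗ i) s'') x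
  have h2 := LinearMap.congr_fun (hF (f ∘ₗ j) s') x
  simp only [LinearMap.comp_apply, LinearMap.zero_apply, hs'', map_sub] at h1 h2 ⊢
  rw [h2, sub_zero] at h1
  exact h1

lemma HasFilt.hom_eq_zero {Θ : ModPred A} {D : Type} [AddCommGroup D] [Module A D]
    (hΘ : ∀ (T : Type) [AddCommGroup T] [Module A T], Θ T → ∀ φ : T →ₗ[A] D, φ = 0)
    {M : Type} [AddCommGroup M] [Module A M] (h : HasFilt A Θ M) :
    ∀ φ : M →ₗ[A] D, φ = 0 := by
  induction h with
  | of_subsingleton M hM =>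
    intro φ
    ext x
    rw [Subsingleton.elim x 0, map_zero, map_zero]
  | step K M Q i p hi hp hex hQ hK ih =>
    intro φ
    have hφi := ih (φ ∘ₗ i)
    have hle : LinearMap.ker p ≤ LinearMap.ker φ := fun x hx => by
      obtain ⟨y, rfl⟩ := (hex x).1 hx
      exact LinearMap.congr_fun hφi y
    have := hΘ Q hQ ((LinearMap.ker p).liftQ φ hle ∘ₗ
      (p.quotKerEquivOfSurjective hp).symm.toLinearMap)
    ext x
    have hx := LinearMap.congr_fun this (p x)
    have hsymm : (p.quotKerEquivOfSurjective hp).symm (p x) = Submodule.Quotient.mk x := by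
      rw [LinearEquiv.symm_apply_eq]; rfl
    simpa [hsymm] using hx

lemma HasFilt.exists_dominates [Module.Projective A P] {e : Module.End A P} {Θ : ModPred A}
    {I : Type} {X : I → Type} [∀ i, AddCommGroup (X i)] [∀ i, Module A (X i)]
    [∀ i, Module.Projective A (X i)]
    (hΘ : ∀ (T : Type) [AddCommGroup T] [Module A T], Θ T →
      ∃ (i : I) (n : ℕ) (t : (Fin n → X i) →ₗ[A] T), Surjective t)
    {M : Type} [AddCommGroup M] [Module A M] (h : HasFilt A Θ M) (hM : Dominates e M) :
    ∃ i, Dominates e (X i) := by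
  induction h with
  | of_subsingleton M hM' =>
    obtain ⟨f, s, hfs⟩ := hM
    refine absurd (LinearMap.ext fun x => ?_) hfs
    simp [Subsingleton.elim (s x) 0]
  | step K M Q i p hi hp hex hQ hK ih =>
    obtain ⟨k, n, t, ht⟩ := hΘ Q hQ
    have : Module.Projective A (Fin n → X k) :=
      .of_equiv (DFinsupp.linearEquivFunOnFintype (R := A) (M := fun _ : Fin n => X k))
    rcases hM.of_extension hi hp hex ht with h | h
    · exact ih h
    · exact ⟨k, h.exists_of_pi.choose_spec⟩

lemma Dominates.regular_of_ne_zero [Module.Finite A P] [Module.Projective A P]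
    {e : Module.End A P} (he : e ≠ 0) : Dominates e A := by
  obtain ⟨n, f, g, -, -, hfg⟩ := Module.Finite.exists_comp_eq_id_of_projective A P
  have : Dominates e (Fin n → A) := ⟨f, g, by rwa [hfg, LinearMap.comp_id]⟩
  exact this.exists_of_pi.choose_spec

end Domination

namespace SplitQH

variable {R : Type} [CommRing R] {A : Type} [Ring A] [Algebra R A]
  {P : Type} [AddCommGroup P] [Module A P] [Module.Finite A P] [Module.Projective A P]

instance (S : SplitQH R A) (l : S.Λ) : Module.Projective A (S.Pr l) := S.pproj l

lemma hom_eq_zero_of_summand (S : SplitQH R A) {l m : S.Λ} (hlm : l < m) {n : ℕ} {T : Type}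
    [AddCommGroup T] [Module A T] (hT : IsSummandOf A T (Fin n → S.Δ m)) (φ : T →ₗ[A] S.Δ l) :
    φ = 0 := by
  classical
  obtain ⟨i, r, hri⟩ := hT
  have h0 : φ ∘ₗ r = 0 := LinearMap.pi_ext' fun k => by
    by_contra hne
    exact hlm.not_ge (S.hom_le m l ⟨_, hne⟩)
  rw [← LinearMap.comp_id φ, ← hri, ← LinearMap.comp_assoc, h0, LinearMap.zero_comp]

/-- Every homomorphism `Pr l → Δ l` is a scalar multiple of the canonical projection. -/
lemma exists_eq_smul_π (S : SplitQH R A) (l : S.Λ) (φ : S.Pr l →ₗ[A] S.Δ l) :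
    ∃ c : R, φ = c • S.π l := by
  obtain ⟨C, ι, -, hex, hfilt⟩ := S.kernel_filtered l
  have h0 : φ ∘ₗ ι = 0 := hfilt.hom_eq_zero
    (fun T _ _ ⟨m, hlm, n, hT⟩ ψ => S.hom_eq_zero_of_summand hlm hT ψ) _
  have hle : LinearMap.ker (S.π l) ≤ LinearMap.ker φ := fun x hx => by
    obtain ⟨y, rfl⟩ := (hex x).1 hx
    exact LinearMap.congr_fun h0 y
  obtain ⟨c, hc⟩ := S.endo l ((LinearMap.ker (S.π l)).liftQ φ hle ∘ₗ
      ((S.π l).quotKerEquivOfSurjective (S.hπ l)).symm.toLinearMap)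
  refine ⟨c, LinearMap.ext fun x => ?_⟩
  have hx := LinearMap.congr_fun hc (S.π l x)
  have hsymm : ((S.π l).quotKerEquivOfSurjective (S.hπ l)).symm (S.π l x) =
      Submodule.Quotient.mk x := by
    rw [LinearEquiv.symm_apply_eq]; rfl
  simpa [hsymm] using hx

/-- A nonzero endomorphism `e` of a finitely generated projective module picks out a weight
`l` such that `Pr l` dominates `e` while the kernel of `Pr l → Δ l` does not. -/
lemma exists_dominates_of_ne_zero (S : SplitQH R A) {e : Module.End A P} (he : e ≠ 0) :
    ∃ l, Dominates e (S.Pr l) ∧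
      ∀ (f : S.Pr l →ₗ[A] P) (s : P →ₗ[A] S.Pr l), S.π l ∘ₗ s = 0 → e ∘ₗ f ∘ₗ s = 0 := by
  classical
  have hne : ∃ l, Dominates e (S.Pr l) := by
    obtain ⟨n, hn⟩ := S.progen
    exact ((Dominates.regular_of_ne_zero he).of_summand hn).exists_of_pi.choose_spec.exists_of_pi
  obtain ⟨l, hl⟩ := (Set.toFinite {l | Dominates e (S.Pr l)}).exists_maximal hne
  refine ⟨l, hl.prop, fun f s hs => ?_⟩
  by_contra hfs
  obtain ⟨C, ι, hι, hex, hfilt⟩ := S.kernel_filtered l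
  have hrange : ∀ x, s x ∈ LinearMap.range ι := fun x =>
    (hex _).1 (LinearMap.congr_fun hs x)
  let s' : P →ₗ[A] C := (LinearEquiv.ofInjective ι hι).symm.toLinearMap ∘ₗ
    s.codRestrict _ hrange
  have hs' : ι ∘ₗ s' = s := LinearMap.ext fun x =>
    congrArg Subtype.val ((LinearEquiv.ofInjective ι hι).apply_symm_apply ⟨_, hrange x⟩)
  have hC : Dominates e C := ⟨f ∘ₗ ι, s', by rwa [LinearMap.comp_assoc, hs']⟩
  obtain ⟨⟨m, hm⟩, hdom⟩ := hfilt.exists_dominates (I := {m // l < m}) (X := fun m => S.Pr m)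
    (fun T _ _ ⟨m, hlm, n, i, r, hri⟩ => ⟨⟨m, hlm⟩, n,
      r ∘ₗ (S.π m).compLeft (Fin n), by
        rw [LinearMap.coe_comp]
        refine Surjective.comp (g := r) (fun x => ⟨i x, LinearMap.congr_fun hri x⟩) fun v => ?_
        choose w hw using fun k => S.hπ m (v k)
        exact ⟨w, funext hw⟩⟩) hC
  exact hm.not_ge (hl.2 hdom hm.le)

end SplitQH

lemma eq_zero_of_mul_self_add_mul_add_mul_self {R : Type} [CommRing R] [IsDomain R] [CharZero R]
    (hR : ∀ x : R, ∃ s m : ℤ, s ≠ 0 ∧ s * x = m) {x y : R} (h : x * x + x * y + y * y = 0) :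
    x = 0 := by
  obtain ⟨s, m, hs, hm⟩ := hR x
  obtain ⟨t, k, ht, hk⟩ := hR y
  have hint : (t * m) * (t * m) + (t * m) * (s * k) + (s * k) * (s * k) = 0 := by
    have : (((t * m) * (t * m) + (t * m) * (s * k) + (s * k) * (s * k) : ℤ) : R) = 0 := by
      push_cast
      rw [← hm, ← hk]
      linear_combination (s * s * t * t : R) * h
    exact_mod_cast this
  have hm0 : m = 0 := by
    by_contra hm0
    have : 0 < (t * m) ^ 2 := by positivity
    nlinarith [sq_nonneg (2 * (s * k) + t * m)]
  rw [hm0, Int.cast_zero] at hm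
  exact (mul_eq_zero.1 hm).resolve_left (by exact_mod_cast hs)

/-- Let `P` be a finitely generated projective module over a split quasi-hereditary algebra.
Then `End_A(P)` has no corner which is, up to torsion, the ring of Eisenstein integers. -/
lemma SplitQH.false_of_eisenstein {R : Type} [CommRing R] [IsDomain R] [CharZero R]
    (hR : ∀ x : R, ∃ s m : ℤ, s ≠ 0 ∧ s * x = m)
    {A : Type} [Ring A] [Algebra R A] (S : SplitQH R A)
    {P : Type} [AddCommGroup P] [Module A P] [Module.Finite A P] [Module.Projective A P]
    (e g : Module.End A P) (heg : g * e = e * g) (hee : e * e = 3 • e)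
    (hg : e * (1 + g + g * g) = 0) (he : ∀ n : ℤ, n ≠ 0 → n • e ≠ 0)
    (hinv : ∀ a, e * a ≠ 0 → ∃ (b : Module.End A P) (n : ℤ), n ≠ 0 ∧ b * (e * a) = n • e) :
    False := by
  obtain ⟨l, ⟨f, s, hfs⟩, hker⟩ :=
    S.exists_dominates_of_ne_zero (e := e) (by simpa using he 1 one_ne_zero)
  have := (S.rproj l).2
  have htf : ∀ (c : R) (q : P →ₗ[A] S.Δ l), c • q = 0 → c = 0 ∨ q = 0 := fun c q h => by
    by_cases hc : c = 0
    · exact Or.inl hc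
    refine Or.inr (LinearMap.ext fun x => ?_)
    have hx : c • q x = 0 := LinearMap.congr_fun h x
    exact (smul_eq_zero.1 hx).resolve_left hc
  obtain ⟨b, n, hn, hb⟩ := hinv (f ∘ₗ s) hfs
  obtain ⟨r, hr⟩ : ∃ r : S.Pr l →ₗ[A] P, r = b ∘ₗ e ∘ₗ f := ⟨_, rfl⟩
  have hrs : r ∘ₗ s = n • e := by rw [hr]; exact hb
  obtain ⟨q, hq⟩ : ∃ q : P →ₗ[A] S.Δ l, q = S.π l ∘ₗ s ∘ₗ e := ⟨_, rfl⟩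
  have hq0 : q ≠ 0 := by
    intro h0
    have h := hker r (s ∘ₗ e) (by rw [← hq, h0])
    rw [← LinearMap.comp_assoc e s r, hrs] at h
    refine he (9 * n) (by simpa using hn) ?_
    have h' : e * (n • e * e) = 0 := h
    rw [smul_mul_assoc, mul_smul_comm, hee, mul_smul_comm, hee] at h'
    rw [← h', mul_comm, mul_smul]
    congr 1
    module
  have hqe : q ∘ₗ e = (3 : R) • q := by
    have : e ∘ₗ e = 3 • e := hee
    rw [hq, LinearMap.comp_assoc, LinearMap.comp_assoc, this]
    ext x
    simp [ofNat_smul_eq_nsmul]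
  have hqg : q + q ∘ₗ g + q ∘ₗ g ∘ₗ g = 0 := by
    refine (htf 3 _ ?_).resolve_left (by norm_num)
    ext x
    have h1 := fun y => LinearMap.congr_fun hqe y
    have h2 := congrArg q (LinearMap.congr_fun hg x)
    simp only [LinearMap.comp_apply, LinearMap.smul_apply] at h1
    rw [Module.End.mul_apply, h1] at h2
    simpa using h2
  obtain ⟨c, hc⟩ := S.exists_eq_smul_π l ((q ∘ₗ g) ∘ₗ r)
  have hc' : (9 * n : R) • (q ∘ₗ g) = c • q := by
    ext x
    have h1 := LinearMap.congr_fun hc (s (e x))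
    have h2 : r (s (e x)) = n • e (e x) := LinearMap.congr_fun hrs (e x)
    have h3 : e (e x) = 3 • e x := LinearMap.congr_fun hee x
    have h4 : g (e x) = e (g x) := LinearMap.congr_fun heg x
    have h5 : q (e (g x)) = (3 : R) • q (g x) := LinearMap.congr_fun hqe (g x)
    have h6 : q x = S.π l (s (e x)) := by rw [hq]; rfl
    simp only [LinearMap.comp_apply, LinearMap.smul_apply, h2, h3, h4, h5, map_zsmul,
      map_nsmul] at h1 ⊢
    rw [h6, ← h1, ← Int.cast_smul_eq_zsmul R, ← Nat.cast_smul_eq_nsmul R, smul_smul, smul_smul]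
    congr 1
    push_cast
    ring
  obtain ⟨N, hN⟩ : ∃ N : R, N = 9 * n := ⟨_, rfl⟩
  rw [← hN] at hc'
  have hc2 : (N * N) • (q ∘ₗ g ∘ₗ g) = (c * c) • q := by
    have : N • (q ∘ₗ g ∘ₗ g) = c • (q ∘ₗ g) := by
      ext x; exact LinearMap.congr_fun hc' (g x)
    rw [mul_smul, this, smul_comm, hc', ← mul_smul]
  have hquad : (N * N + c * N + c * c) • q = 0 := by
    have := congrArg (fun z => (N * N) • z) hqg
    simp only [smul_add, smul_zero, hc2] at this
    rw [mul_smul N N (q ∘ₗ g), hc', smul_smul] at this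
    rw [← this, add_smul, add_smul, mul_comm c N]
  have hz := (htf _ _ hquad).resolve_right hq0
  have h9 : (9 * n : R) = 0 :=
    hN ▸ eq_zero_of_mul_self_add_mul_add_mul_self hR (y := c) (by linear_combination hz)
  exact hn (by simpa using h9)

section GroupAlgebra

variable {R : Type} [CommRing R]

lemma MonoidAlgebra.exists_eq_smul_zmod_three (a : MonoidAlgebra R (Multiplicative (ZMod 3))) :
    ∃ x y z : R, a = algebraMap R _ x + algebraMap R _ y * .of R _ (.ofAdd 1) +
      algebraMap R _ z * .of R _ (.ofAdd 1) ^ 2 := by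
  induction a using MonoidAlgebra.induction_linear with
  | zero => exact ⟨0, 0, 0, by simp⟩
  | add a b ha hb =>
    obtain ⟨x, y, z, rfl⟩ := ha
    obtain ⟨x', y', z', rfl⟩ := hb
    exact ⟨x + x', y + y', z + z', by simp only [map_add]; ring⟩
  | single i r =>
    have hi : i = .ofAdd 0 ∨ i = .ofAdd 1 ∨ i = .ofAdd 1 ^ 2 := by revert i; decide
    rcases hi with rfl | rfl | rfl
    · exact ⟨r, 0, 0, by simp⟩
    · exact ⟨0, r, 0, by simp⟩
    · exact ⟨0, 0, r, by simp⟩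

lemma MonoidAlgebra.zsmul_two_sub_of_sub_of_sq_ne_zero [CharZero R] {n : ℤ} (hn : n ≠ 0) :
    n • (2 - .of R _ (.ofAdd 1) - .of R _ (.ofAdd 1) ^ 2 :
      MonoidAlgebra R (Multiplicative (ZMod 3))) ≠ 0 := by
  intro h
  have h1 := congrArg (fun z : MonoidAlgebra R (Multiplicative (ZMod 3)) => z.coeff 1) h
  rw [← map_pow, ← one_add_one_eq_two] at h1
  have hg : (Multiplicative.ofAdd 1 : Multiplicative (ZMod 3)) ≠ 1 := by decide
  have hg2 : (Multiplicative.ofAdd 1 ^ 2 : Multiplicative (ZMod 3)) ≠ 1 := by decide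
  simp [-zsmul_eq_mul, MonoidAlgebra.one_def, hg, hg2] at h1
  exact hn (self_eq_neg.1 (Int.cast_injective (α := R) (by
    simpa using eq_neg_of_add_eq_zero_left h1)))

end GroupAlgebra

lemma SplitQHCover.isEmpty_of_groupAlgebra {R : Type} [CommRing R] [IsDomain R] [CharZero R]
    (hR : ∀ x : R, ∃ s m : ℤ, s ≠ 0 ∧ s * x = m) :
    IsEmpty (SplitQHCover R (MonoidAlgebra R (Multiplicative (ZMod 3)))) := by
  refine ⟨fun Q => ?_⟩
  have := Q.finP
  have := Q.projP
  let C := MonoidAlgebra R (Multiplicative (ZMod 3))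
  let σ : Module.End Q.A Q.Pm ≃+* C :=
    { MulOpposite.opAddEquiv.trans Q.iso.toAddEquiv with
      map_mul' := fun a b => by
        change Q.iso (.op (a * b)) = Q.iso (.op a) * Q.iso (.op b)
        rw [MulOpposite.op_mul, map_mul, mul_comm] }
  obtain ⟨G, hGdef⟩ : ∃ G : C, G = .of R _ (.ofAdd 1) := ⟨_, rfl⟩
  have hG : G ^ 3 = 1 := by
    rw [hGdef, ← map_pow]
    exact map_one _
  have hne : ∀ n : ℤ, n ≠ 0 → n • (2 - G - G ^ 2) ≠ 0 := by
    rw [hGdef]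
    exact fun n hn => MonoidAlgebra.zsmul_two_sub_of_sub_of_sq_ne_zero hn
  refine Q.qh.false_of_eisenstein hR (σ.symm (2 - G - G ^ 2)) (σ.symm G) ?_ ?_ ?_ ?_ ?_
  · rw [← map_mul, ← map_mul, mul_comm]
  · apply σ.injective
    simp only [map_mul, map_nsmul, σ.apply_symm_apply]
    rw [nsmul_eq_mul]
    push_cast
    linear_combination (G + 2) * hG
  · apply σ.injective
    simp only [map_mul, map_add, map_one, map_zero, σ.apply_symm_apply]
    linear_combination (-G - 2) * hG
  · intro n hn h
    exact hne n hn (σ.symm.injective (by rw [map_zsmul, h, map_zero]))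
  · intro a ha
    obtain ⟨x, y, z, hxyz⟩ := MonoidAlgebra.exists_eq_smul_zmod_three (σ a)
    rw [← hGdef] at hxyz
    obtain ⟨s, m, hs, hm⟩ := hR (x ^ 2 + y ^ 2 + z ^ 2 - x * y - y * z - z * x)
    have hsq : x ^ 2 + y ^ 2 + z ^ 2 - x * y - y * z - z * x ≠ 0 := by
      intro h0
      have hxy : x - y = 0 := eq_zero_of_mul_self_add_mul_add_mul_self hR (y := y - z)
        (by linear_combination h0)
      have hyz : y - z = 0 := eq_zero_of_mul_self_add_mul_add_mul_self hR (y := x - y)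
        (by linear_combination h0)
      apply ha
      apply σ.injective
      rw [sub_eq_zero] at hxy hyz
      rw [map_mul, σ.apply_symm_apply, hxyz, hxy, hyz, map_zero]
      linear_combination (-algebraMap R C z) * (G + 2) * hG
    refine ⟨s • σ.symm (algebraMap R C x + algebraMap R C y * G ^ 2 + algebraMap R C z * G),
      m, ?_, ?_⟩
    · rintro rfl
      rw [Int.cast_zero] at hm
      exact (mul_ne_zero (by exact_mod_cast hs) hsq) hm
    · apply σ.injective
      have hm' := congrArg (algebraMap R C) hm
      simp only [map_mul, map_intCast, map_sub, map_add, map_pow] at hm'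
      rw [map_mul, map_mul, map_zsmul, map_zsmul, σ.apply_symm_apply, σ.apply_symm_apply, hxyz,
        zsmul_eq_mul, zsmul_eq_mul, ← hm']
      change _ * (_ * (algebraMap R C x + algebraMap R C y * G + algebraMap R C z * G ^ 2)) = _
      generalize algebraMap R C x = X
      generalize algebraMap R C y = Y
      generalize algebraMap R C z = Z
      linear_combination (s : C) * ((2 - G - G ^ 2) * (Y ^ 2 + Z ^ 2 + Y * Z * G) -
        (X * Y + Y * Z + Z * X) * (2 + G)) * hG

/-- The group algebras `ℤ_{(7)}C₃` (localization of `ℤ` at `7`) and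
`ℤC₃` of the cyclic group of order `3` do not admit a split quasi-hereditary cover. -/
theorem no_splitQH_cover_of_ZC3 :
    IsEmpty (SplitQHCover (Localization.AtPrime (Ideal.span {(7 : ℤ)}))
      (MonoidAlgebra (Localization.AtPrime (Ideal.span {(7 : ℤ)}))
        (Multiplicative (ZMod 3)))) ∧
    IsEmpty (SplitQHCover ℤ (MonoidAlgebra ℤ (Multiplicative (ZMod 3)))) := by
  refine ⟨?_, SplitQHCover.isEmpty_of_groupAlgebra fun x => ⟨1, x, one_ne_zero, by simp⟩⟩
  have hle : (Ideal.span {(7 : ℤ)}).primeCompl ≤ nonZeroDivisors ℤ :=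
    Ideal.primeCompl_le_nonZeroDivisors _
  have : IsDomain (Localization.AtPrime (Ideal.span {(7 : ℤ)})) :=
    IsLocalization.isDomain_localization hle
  have : CharZero (Localization.AtPrime (Ideal.span {(7 : ℤ)})) :=
    charZero_of_injective_algebraMap (IsLocalization.injective _ hle)
  refine SplitQHCover.isEmpty_of_groupAlgebra fun x => ?_
  obtain ⟨⟨m, s⟩, hms⟩ := IsLocalization.surj (Ideal.span {(7 : ℤ)}).primeCompl x
  exact ⟨s, m, nonZeroDivisors.ne_zero (hle s.2), by simpa [mul_comm] using hms⟩
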